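/- Let 𝒞 be a simply connected twin chamber system over a set I, let G be a gallery in Opp(𝒞), and let X be a simple gallery in 𝒞₊ such that the reduced gallery (G₊)* of the 𝒞₊-component G₊ of G is elementary homotopic to X. Then there exists a gallery H in Opp(𝒞) such that H is homotopic to G and the reduced gallery (H₊)* of the 𝒞₊-component of H equals X. -/

import Mathlib

/-! ## Chamber systems, galleries, homotopy, and twin chamber systems -/

namespace TwinChamber

universe u v

variable {I : Type u} {C : Type v}

/-- Two chambers are `i`-adjacent for some `i ∈ J`. -/
def JAdj (adj : I → C → C → Prop) (J : Set I) (c d : C) : Prop := ∃ j ∈ J, adj j c d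

/-- Two chambers are adjacent if they are `i`-adjacent for some `i ∈ I`. -/
def Adj (adj : I → C → C → Prop) (c d : C) : Prop := ∃ i, adj i c d

/-- A gallery is a nonempty finite sequence of chambers in which consecutive chambers are
adjacent. -/
def IsGallery (adj : I → C → C → Prop) (l : List C) : Prop :=
  l ≠ [] ∧ l.Chain' (Adj adj)

/-- `d` lies in the `J`-residue of `c`: there is a `J`-gallery from `c` to `d`. -/
def InResidue (adj : I → C → C → Prop) (J : Set I) (c d : C) : Prop :=
  Relation.ReflTransGen (JAdj adj J) c d

/-- Two galleries are elementary homotopic if they coincide on an initial segment and a final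
segment, and the two intermediate subgalleries are `J`-galleries, with the same first and last
chambers, for some `J ⊆ I` with `|J| ≤ 2`. -/
def ElemHomotopic (adj : I → C → C → Prop) (G H : List C) : Prop :=
  ∃ (P M M' S : List C) (J : Set I),
    J.Finite ∧ J.ncard ≤ 2 ∧
    M ≠ [] ∧ M' ≠ [] ∧
    M.head? = M'.head? ∧ M.getLast? = M'.getLast? ∧
    M.Chain' (JAdj adj J) ∧ M'.Chain' (JAdj adj J) ∧
    G = P ++ M ++ S ∧ H = P ++ M' ++ S

/-- Two galleries are homotopic if they are connected by a finite chain of elementary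
homotopies. -/
def Homotopic (adj : I → C → C → Prop) : List C → List C → Prop :=
  Relation.ReflTransGen (ElemHomotopic adj)

/-- A closed gallery is null-homotopic if it is homotopic to the length-zero gallery at its
initial chamber. -/
def NullHomotopic (adj : I → C → C → Prop) (G : List C) : Prop :=
  ∃ c, G.head? = some c ∧ Homotopic adj G [c]

/-- A chamber system is connected if any two chambers are joined by a gallery. -/
def Connected (adj : I → C → C → Prop) : Prop :=
  ∀ c d : C, Relation.ReflTransGen (Adj adj) c d

/-- A chamber system is simply connected if it is connected and every closed gallery is
null-homotopic. -/
def SimplyConnected (adj : I → C → C → Prop) : Prop :=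
  Connected adj ∧
    ∀ G : List C, IsGallery adj G → G.head? = G.getLast? → NullHomotopic adj G

/-- The reduced gallery of a gallery: delete every chamber equal to its immediate
predecessor. -/
noncomputable def reduced (l : List C) : List C :=
  letI : DecidableEq C := Classical.decEq C
  l.destutter (· ≠ ·)

/-- A twin chamber system over `I`: a pair of chamber systems `(Cp, adjp)`, `(Cm, adjm)` over
`I` (each `adj i` an equivalence relation) together with a symmetric opposition relation `op`
between them, satisfying the axioms (TCS1)–(TCS4) for both signs. -/
structure TwinCS (I : Type u) : Type (max u (v + 1)) where
  /-- The positive chamber set. -/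
  Cp : Type v
  /-- The negative chamber set. -/
  Cm : Type v
  /-- `i`-adjacency on `Cp`. -/
  adjp : I → Cp → Cp → Prop
  /-- `i`-adjacency on `Cm`. -/
  adjm : I → Cm → Cm → Prop
  eqvp : ∀ i, Equivalence (adjp i)
  eqvm : ∀ i, Equivalence (adjm i)
  /-- The opposition relation between `Cp` and `Cm`. -/
  op : Cp → Cm → Prop
  tcs1p : ∀ (i j : I) (c d : Cp) (x y : Cm), adjp i c d → adjm j x y →
    op d x → op c x → op c y → op d y ∨ j = i
  tcs1m : ∀ (i j : I) (c d : Cm) (x y : Cp), adjm i c d → adjp j x y →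
    op x d → op x c → op y c → op y d ∨ j = i
  tcs2p : ∀ (i : I) (c d : Cp) (x : Cm), adjp i c d → op c x →
    ∃ y : Cm, adjm i x y ∧ op c y ∧ op d y
  tcs2m : ∀ (i : I) (c d : Cm) (x : Cp), adjm i c d → op x c →
    ∃ y : Cp, adjp i x y ∧ op y c ∧ op y d
  tcs3p : ∀ (c : Cp) (x y : Cm), op c x → op c y →
    Relation.ReflTransGen (fun u v => op c u ∧ op c v ∧ Adj adjm u v) x y
  tcs3pJ : ∀ (c : Cp) (J : Set I), J.Finite → J.ncard ≤ 2 → ∀ x y : Cm, op c x → op c y →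
    InResidue adjm J x y →
    Relation.ReflTransGen (fun u v => op c u ∧ op c v ∧ JAdj adjm J u v) x y
  tcs3m : ∀ (c : Cm) (x y : Cp), op x c → op y c →
    Relation.ReflTransGen (fun u v => op u c ∧ op v c ∧ Adj adjp u v) x y
  tcs3mJ : ∀ (c : Cm) (J : Set I), J.Finite → J.ncard ≤ 2 → ∀ x y : Cp, op x c → op y c →
    InResidue adjp J x y →
    Relation.ReflTransGen (fun u v => op u c ∧ op v c ∧ JAdj adjp J u v) x y
  tcs4p : ∀ c : Cp, ∃ ω : Cm → Cp,
    (∀ (i : I) (x y : Cm), adjm i x y → adjp i (ω x) (ω y)) ∧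
    (∀ x, op (ω x) x) ∧ (∀ x, op c x → ω x = c)
  tcs4m : ∀ c : Cm, ∃ ω : Cp → Cm,
    (∀ (i : I) (x y : Cp), adjp i x y → adjm i (ω x) (ω y)) ∧
    (∀ x, op x (ω x)) ∧ (∀ x, op x c → ω x = c)

/-- The chambers of `Opp(𝒞)`: pairs of opposite chambers. -/
def OppC (T : TwinCS.{u, v} I) : Type v := {p : T.Cp × T.Cm // T.op p.1 p.2}

/-- `i`-adjacency on `Opp(𝒞)`: componentwise `i`-adjacency. -/
def oppAdj (T : TwinCS.{u, v} I) : I → OppC T → OppC T → Prop :=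
  fun i u v => T.adjp i u.1.1 v.1.1 ∧ T.adjm i u.1.2 v.1.2

/-- A twin chamber system is simply connected if both of its halves are simply connected
chamber systems. -/
def TwinSC (T : TwinCS.{u, v} I) : Prop :=
  SimplyConnected T.adjp ∧ SimplyConnected T.adjm


section Homotopy

variable {adj : I → C → C → Prop}

theorem ElemHomotopic.symm {G H : List C} (h : ElemHomotopic adj G H) :
    ElemHomotopic adj H G := by
  obtain ⟨P, M, M', S, J, h1, h2, h3, h4, h5, h6, h7, h8, h9, h10⟩ := h
  exact ⟨P, M', M, S, J, h1, h2, h4, h3, h5.symm, h6.symm, h8, h7, h10, h9⟩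

theorem Homotopic.symm {G H : List C} (h : Homotopic adj G H) : Homotopic adj H G := by
  induction h with
  | refl => exact .refl
  | tail _ h ih => exact .head h.symm ih

theorem Homotopic.append_right {G H : List C} (h : Homotopic adj G H) (S : List C) :
    Homotopic adj (G ++ S) (H ++ S) := by
  refine Relation.ReflTransGen.lift (· ++ S) ?_ _ _ h
  rintro _ _ ⟨P, M, M', S', J, h1, h2, h3, h4, h5, h6, h7, h8, rfl, rfl⟩
  exact ⟨P, M, M', S' ++ S, J, h1, h2, h3, h4, h5, h6, h7, h8, by simp, by simp⟩

theorem Homotopic.cons {G H : List C} (h : Homotopic adj G H) (a : C) :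
    Homotopic adj (a :: G) (a :: H) := by
  refine Relation.ReflTransGen.lift (a :: ·) ?_ _ _ h
  rintro _ _ ⟨P, M, M', S, J, h1, h2, h3, h4, h5, h6, h7, h8, rfl, rfl⟩
  exact ⟨a :: P, M, M', S, J, h1, h2, h3, h4, h5, h6, h7, h8, by simp, by simp⟩

/-- Adjacency-preserving maps preserve homotopy. -/
theorem Homotopic.map {D : Type*} {adj' : I → D → D → Prop} (f : C → D)
    (hf : ∀ i x y, adj i x y → adj' i (f x) (f y)) {G H : List C} (h : Homotopic adj G H) :
    Homotopic adj' (G.map f) (H.map f) := by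
  refine Relation.ReflTransGen.lift (List.map f) ?_ _ _ h
  rintro _ _ ⟨P, M, M', S, J, h1, h2, h3, h4, h5, h6, h7, h8, rfl, rfl⟩
  have key : ∀ N : List C, N.IsChain (JAdj adj J) → (N.map f).IsChain (JAdj adj' J) := by
    intro N hN
    rw [List.isChain_map]
    exact hN.imp fun x y ⟨j, hj, h⟩ => ⟨j, hj, hf j x y h⟩
  exact ⟨P.map f, M.map f, M'.map f, S.map f, J, h1, h2, by simpa, by simpa,
    by simp [h5], by simp [h6], key _ h7, key _ h8, by simp, by simp⟩

/-- `JPath adj J a l b`: the list `a :: l` is a `J`-gallery from `a` to `b`. -/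
inductive JPath (adj : I → C → C → Prop) (J : Set I) : C → List C → C → Prop
  | nil (a : C) : JPath adj J a [] a
  | cons {a c b : C} {l : List C} : JAdj adj J a c → JPath adj J c l b → JPath adj J a (c :: l) b

theorem JPath.append {J : Set I} {a b c : C} {l l' : List C} (h : JPath adj J a l b)
    (h' : JPath adj J b l' c) : JPath adj J a (l ++ l') c := by
  induction h with
  | nil => exact h'
  | cons h _ ih => exact .cons h (ih h')

theorem JPath.isChain {J : Set I} {a b : C} {l : List C} (h : JPath adj J a l b) :
    (a :: l).IsChain (JAdj adj J) := by
  induction h with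
  | nil => simp
  | cons h _ ih => exact List.isChain_cons_cons.2 ⟨h, ih⟩

theorem JPath.getLast? {J : Set I} {a b : C} {l : List C} (h : JPath adj J a l b) :
    (a :: l).getLast? = some b := by
  induction h with
  | nil => simp
  | cons h _ ih => rw [List.getLast?_cons_cons, ih]

theorem JPath.of_isChain {J : Set I} {b : C} : ∀ {a : C} {l : List C},
    (a :: l).IsChain (JAdj adj J) → (a :: l).getLast? = some b → JPath adj J a l b
  | a, [], _, h => by
    obtain rfl : a = b := by simpa using h
    exact .nil a
  | a, c :: l, hc, h => by
    rw [List.isChain_cons_cons] at hc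
    rw [List.getLast?_cons_cons] at h
    exact .cons hc.1 (JPath.of_isChain hc.2 h)

theorem JPath.homotopic {J : Set I} (hJ : J.Finite) (hJ2 : J.ncard ≤ 2) {a b : C}
    {l l' : List C} (h : JPath adj J a l b) (h' : JPath adj J a l' b) :
    Homotopic adj (a :: l) (a :: l') :=
  .single ⟨[], a :: l, a :: l', [], J, hJ, hJ2, by simp, by simp, by simp,
    h.getLast?.trans h'.getLast?.symm, h.isChain, h'.isChain, by simp, by simp⟩

end Homotopy

section Reduced

theorem reduced_singleton (a : C) : reduced [a] = [a] := by
  simp [reduced]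

theorem reduced_cons_self (a : C) (l : List C) : reduced (a :: a :: l) = reduced (a :: l) := by
  simp [reduced, List.destutter_cons']

theorem reduced_cons_of_ne {a b : C} (h : a ≠ b) (l : List C) :
    reduced (a :: b :: l) = a :: reduced (b :: l) := by
  simp [reduced, List.destutter_cons', h]

end Reduced

section Lift

variable {T : TwinCS.{u, v} I}

/-- `Lift a l b s`: the list `a :: l` is a gallery in `Opp(𝒞)` from `a` to `b`, and the reduced
gallery of its `𝒞₊`-component is `a.1.1 :: s`. -/
inductive Lift : OppC T → List (OppC T) → OppC T → List T.Cp → Prop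
  | nil (a : OppC T) : Lift a [] a []
  | stay {a c b : OppC T} {l : List (OppC T)} {s : List T.Cp} : Adj (oppAdj T) a c →
      a.1.1 = c.1.1 → Lift c l b s → Lift a (c :: l) b s
  | move {a c b : OppC T} {l : List (OppC T)} {s : List T.Cp} : Adj (oppAdj T) a c →
      a.1.1 ≠ c.1.1 → Lift c l b s → Lift a (c :: l) b (c.1.1 :: s)

theorem Lift.append {a b c : OppC T} {l l' : List (OppC T)} {s s' : List T.Cp}
    (h : Lift a l b s) (h' : Lift b l' c s') : Lift a (l ++ l') c (s ++ s') := by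
  induction h with
  | nil => exact h'
  | stay h e _ ih => exact .stay h e (ih h')
  | move h e _ ih => exact .move h e (ih h')

theorem Lift.isChain {a b : OppC T} {l : List (OppC T)} {s : List T.Cp} (h : Lift a l b s) :
    (a :: l).IsChain (Adj (oppAdj T)) := by
  induction h with
  | nil => simp
  | stay h _ _ ih => exact List.isChain_cons_cons.2 ⟨h, ih⟩
  | move h _ _ ih => exact List.isChain_cons_cons.2 ⟨h, ih⟩

theorem Lift.reduced_eq {a b : OppC T} {l : List (OppC T)} {s : List T.Cp} (h : Lift a l b s) :
    reduced ((a :: l).map (fun u => u.1.1)) = a.1.1 :: s := by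
  induction h with
  | nil => simp [reduced_singleton]
  | stay h e _ ih =>
    rw [List.map_cons, List.map_cons, e, reduced_cons_self]
    exact ih
  | move h e _ ih =>
    rw [List.map_cons, List.map_cons, reduced_cons_of_ne e]
    exact congrArg _ ih

theorem Lift.exists_of_isChain : ∀ {a : OppC T} {l : List (OppC T)},
    (a :: l).IsChain (Adj (oppAdj T)) → ∃ b s, Lift a l b s
  | a, [], _ => ⟨a, [], .nil a⟩
  | a, c :: l, h => by
    rw [List.isChain_cons_cons] at h
    obtain ⟨b, s, hs⟩ := Lift.exists_of_isChain h.2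
    by_cases e : a.1.1 = c.1.1
    · exact ⟨b, s, .stay h.1 e hs⟩
    · exact ⟨b, _, .move h.1 e hs⟩

theorem Lift.getLast? {a b : OppC T} {l : List (OppC T)} {s : List T.Cp} (h : Lift a l b s) :
    (a.1.1 :: s).getLast? = some b.1.1 := by
  induction h with
  | nil => simp
  | stay _ e _ ih => rw [e, ih]
  | move _ _ _ ih => rw [List.getLast?_cons_cons, ih]

theorem Lift.fst_eq {a b : OppC T} {l : List (OppC T)} (h : Lift a l b []) :
    a.1.1 = b.1.1 := by
  simpa using h.getLast?

theorem Lift.split {a b : OppC T} {l : List (OppC T)} {s s' : List T.Cp}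
    (h : Lift a l b (s ++ s')) :
    ∃ e k k', l = k ++ k' ∧ Lift a k e s ∧ Lift e k' b s' := by
  generalize ht : s ++ s' = t at h
  induction h generalizing s with
  | nil a =>
    obtain ⟨rfl, rfl⟩ := List.append_eq_nil_iff.1 ht
    exact ⟨a, [], [], rfl, .nil a, .nil a⟩
  | stay h e _ ih =>
    obtain ⟨x, k, k', rfl, h1, h2⟩ := ih ht
    exact ⟨x, _ :: k, k', rfl, .stay h e h1, h2⟩
  | @move a c b l t h e hl ih =>
    cases s with
    | nil =>
      obtain rfl : s' = _ := ht
      exact ⟨a, [], c :: l, rfl, .nil a, .move h e hl⟩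
    | cons d s =>
      obtain ⟨rfl, rfl⟩ := List.cons_eq_cons.1 ht
      obtain ⟨x, k, k', rfl, h1, h2⟩ := ih rfl
      exact ⟨x, c :: k, k', rfl, .move h e h1, h2⟩

theorem Lift.split_cons {a b : OppC T} {l : List (OppC T)} {d : T.Cp} {s : List T.Cp}
    (h : Lift a l b (d :: s)) :
    ∃ x y k k', l = k ++ y :: k' ∧ Lift a k x [] ∧ Adj (oppAdj T) x y ∧ x.1.1 ≠ y.1.1 ∧
      y.1.1 = d ∧ Lift y k' b s := by
  generalize ht : d :: s = t at h
  induction h with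
  | nil a => cases ht
  | stay h e _ ih =>
    obtain ⟨x, y, k, k', rfl, h1, h2⟩ := ih ht
    exact ⟨x, y, _ :: k, k', rfl, .stay h e h1, h2⟩
  | @move a c b l t h e hl ih =>
    obtain ⟨rfl, rfl⟩ := List.cons_eq_cons.1 ht
    exact ⟨a, c, [], l, rfl, .nil a, h, e, rfl, hl⟩

theorem Homotopic.lift_append {a b : OppC T} {l k k' : List (OppC T)} {s : List T.Cp}
    (h : Lift a l b s) (hk : Homotopic (oppAdj T) (b :: k) (b :: k')) :
    Homotopic (oppAdj T) (a :: (l ++ k)) (a :: (l ++ k')) := by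
  induction h with
  | nil => exact hk
  | stay _ _ _ ih => exact (ih hk).cons _
  | move _ _ _ ih => exact (ih hk).cons _

/-- Any two chambers of `Opp(𝒞)` with the same `𝒞₊`-component are joined by a gallery with
constant `𝒞₊`-component. -/
theorem exists_lift_const {a b : OppC T} (h : a.1.1 = b.1.1) : ∃ l, Lift a l b [] := by
  obtain ⟨⟨c, x⟩, ha⟩ := a
  obtain ⟨⟨c', y⟩, hb⟩ := b
  obtain rfl : c = c' := h
  have H := T.tcs3p c x y ha hb
  revert ha
  induction H using Relation.ReflTransGen.head_induction_on with
  | refl => exact fun _ => ⟨[], .nil _⟩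
  | @head u w huw _ ih =>
    intro ha
    obtain ⟨l, hl⟩ := ih huw.2.1
    obtain ⟨i, hi⟩ := huw.2.2
    exact ⟨⟨(c, w), huw.2.1⟩ :: l, .stay ⟨i, (T.eqvp i).refl c, hi⟩ rfl hl⟩

/-- Two chambers of `Opp(𝒞)` with the same `𝒞₊`-component and with `𝒞₋`-components in the same
`J`-residue, `|J| ≤ 2`, are joined by a `J`-gallery with constant `𝒞₊`-component. -/
theorem exists_jPath_lift_const {J : Set I} (hJ : J.Finite) (hJ2 : J.ncard ≤ 2)
    {a b : OppC T} (h : a.1.1 = b.1.1) (hab : InResidue T.adjm J a.1.2 b.1.2) :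
    ∃ l, JPath (oppAdj T) J a l b ∧ Lift a l b [] := by
  obtain ⟨⟨c, x⟩, ha⟩ := a
  obtain ⟨⟨c', y⟩, hb⟩ := b
  obtain rfl : c = c' := h
  have H := T.tcs3pJ c J hJ hJ2 x y ha hb hab
  clear hab
  revert ha
  induction H using Relation.ReflTransGen.head_induction_on with
  | refl => exact fun _ => ⟨[], .nil _, .nil _⟩
  | @head u w huw _ ih =>
    intro ha
    obtain ⟨l, hl, hl'⟩ := ih huw.2.1
    obtain ⟨i, hiJ, hi⟩ := huw.2.2
    exact ⟨_, .cons ⟨i, hiJ, (T.eqvp i).refl c, hi⟩ hl, .stay ⟨i, (T.eqvp i).refl c, hi⟩ rfl hl'⟩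

/-- A closed gallery in `Opp(𝒞)` with constant `𝒞₊`-component is null-homotopic. -/
theorem Lift.homotopic_nil (hT : TwinSC T) {a : OppC T} {l : List (OppC T)}
    (h : Lift a l a []) : Homotopic (oppAdj T) (a :: l) [a] := by
  obtain ⟨ω, hω, hop, hfix⟩ := T.tcs4p a.1.1
  let F : T.Cm → OppC T := fun x => ⟨(ω x, x), hop x⟩
  have hF : ∀ u : OppC T, u.1.1 = a.1.1 → F u.1.2 = u := by
    rintro ⟨⟨c, x⟩, hu⟩ (rfl : c = _)
    exact Subtype.ext (Prod.ext (hfix x hu) rfl)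
  have hmem : ∀ {b c : OppC T} {l : List (OppC T)}, Lift b l c [] →
      ∀ u ∈ b :: l, u.1.1 = c.1.1 := by
    intro b c l hb
    generalize ht : ([] : List T.Cp) = t at hb
    induction hb with
    | nil => simp
    | stay _ e _ ih =>
      have := ih ht
      rintro u (_ | ⟨_, hu⟩)
      · rw [e]; exact this _ (by simp)
      · exact this u hu
    | move => cases ht
  have hlast : ∀ {b c : OppC T} {l : List (OppC T)} {s : List T.Cp}, Lift b l c s →
      (b :: l).getLast? = some c := by
    intro b c l s hb
    induction hb with
    | nil => simp
    | stay _ _ _ ih => rw [List.getLast?_cons_cons, ih]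
    | move _ _ _ ih => rw [List.getLast?_cons_cons, ih]
  have hnull := hT.2.2 ((a :: l).map fun u => u.1.2)
    ⟨by simp, by
      change List.IsChain _ _
      rw [List.isChain_map]
      exact h.isChain.imp fun x y ⟨i, hi⟩ => ⟨i, hi.2⟩⟩
    (by rw [List.getLast?_map, hlast h]; simp)
  obtain ⟨c, hc, hh⟩ := hnull
  obtain rfl : a.1.2 = c := by simpa using hc
  have := hh.map (adj' := oppAdj T) F fun i x y hxy => ⟨hω i x y hxy, hxy⟩
  rw [List.map_map, List.map_singleton, hF a rfl] at this
  convert this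
  refine (List.map_id _).symm.trans (List.map_congr_left fun u hu => ?_)
  exact (hF u (hmem h u hu)).symm

/-- Two galleries in `Opp(𝒞)` with the same extremities and the same constant `𝒞₊`-component are
homotopic. -/
theorem Lift.homotopic_const (hT : TwinSC T) {a b : OppC T} {l l' : List (OppC T)}
    (h : Lift a l b []) (h' : Lift a l' b []) :
    Homotopic (oppAdj T) (a :: l) (a :: l') := by
  obtain ⟨k, hk⟩ := exists_lift_const h.fst_eq.symm
  have h1 := Homotopic.lift_append h ((hk.append h').homotopic_nil hT)
  have h2 := ((h.append hk).homotopic_nil hT).append_right l'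
  simp only [List.append_nil, List.append_assoc, List.cons_append, List.nil_append] at h1 h2
  exact h1.symm.trans h2

theorem finite_and_ncard_pair_le (i j : I) :
    ({i, j} : Set I).Finite ∧ ({i, j} : Set I).ncard ≤ 2 :=
  ⟨Set.toFinite _, (Set.ncard_insert_le _ _).trans (by simp)⟩

/-- Galleries with constant `𝒞₊`-component can be transported along an adjacency of `𝒞₊`, up to
homotopy. -/
theorem homotopic_square (hT : TwinSC T) {a a' b b' : OppC T} {R Q : List (OppC T)}
    (hR : Lift a R a' []) (hab : Adj (oppAdj T) a b) (hab' : Adj (oppAdj T) a' b')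
    (hQ : Lift b Q b' []) :
    Homotopic (oppAdj T) (a :: b :: Q) (a :: (R ++ [b'])) := by
  generalize ht : ([] : List T.Cp) = t at hR
  induction hR generalizing b Q with
  | nil a =>
    obtain ⟨i, hi⟩ := hab
    obtain ⟨j, hj⟩ := hab'
    obtain ⟨hJ, hJ2⟩ := finite_and_ncard_pair_le i j
    obtain ⟨l, hl, hl'⟩ := exists_jPath_lift_const hJ hJ2 hQ.fst_eq
      (.head ⟨i, by simp, (T.eqvm i).symm hi.2⟩ (.single ⟨j, by simp, hj.2⟩))
    exact ((hQ.homotopic_const hT hl').cons a).trans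
      (JPath.homotopic hJ hJ2 (.cons ⟨i, by simp, hi⟩ hl) (.cons ⟨j, by simp, hj⟩ (.nil _)))
  | @stay a x a' R s hax e _ ih =>
    obtain ⟨i, hi⟩ := hab
    obtain ⟨j, hj⟩ := hax
    obtain ⟨hJ, hJ2⟩ := finite_and_ncard_pair_le i j
    have hxb : T.adjp i x.1.1 b.1.1 := e ▸ hi.1
    obtain ⟨z, hz, -, hbz⟩ := T.tcs2p i x.1.1 b.1.1 x.1.2 hxb x.2
    let y : OppC T := ⟨(b.1.1, z), hbz⟩
    have hxy : oppAdj T i x y := ⟨hxb, hz⟩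
    obtain ⟨Q', hQ'⟩ := exists_lift_const (a := y) (b := b') hQ.fst_eq
    obtain ⟨l, hl, hl'⟩ := exists_jPath_lift_const (a := b) (b := y) hJ hJ2 rfl
      (.head ⟨i, by simp, (T.eqvm i).symm hi.2⟩
        (.head ⟨j, by simp, hj.2⟩ (.single ⟨i, by simp, hz⟩)))
    have h1 := (ih ⟨i, hxy⟩ hab' hQ' ht).cons a
    have h2 := (JPath.homotopic hJ hJ2 (.cons ⟨i, by simp, hi⟩ hl)
      (.cons ⟨j, by simp, hj⟩ (.cons ⟨i, by simp, hxy⟩ (.nil _)))).append_right Q'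
    exact (((hQ.homotopic_const hT (hl'.append hQ')).cons a).trans h2).trans h1
  | move => cases ht

/-- Two galleries of `Opp(𝒞)` with the same last chamber whose `𝒞₊`-components have the same
reduced gallery are homotopic, after joining their initial chambers. -/
theorem Lift.homotopic_append (hT : TwinSC T) {a a' b : OppC T} {l l' r : List (OppC T)}
    {s : List T.Cp} (h : Lift a l b s) (h' : Lift a' l' b s) (hr : Lift a r a' []) :
    Homotopic (oppAdj T) (a :: l) (a :: (r ++ l')) := by
  induction h generalizing a' l' r with
  | nil a => exact ((hr.append h').homotopic_nil hT).symm
  | @stay a c b l s hac e _ ih =>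
    obtain ⟨k, hk⟩ := exists_lift_const (e.symm.trans hr.fst_eq)
    exact ((ih h' hk).cons a).trans
      (((Lift.stay hac e hk).homotopic_const hT hr).append_right l')
  | @move a c b l s hac _ _ ih =>
    obtain ⟨x, y, k, k', rfl, hk, hxy, -, hyc, hk'⟩ := h'.split_cons
    obtain ⟨q, hq⟩ := exists_lift_const hyc.symm
    have h1 := (homotopic_square hT (hr.append hk) hac hxy hq).append_right k'
    simp only [List.append_assoc, List.cons_append, List.nil_append] at h1
    exact ((ih hk' hq).cons a).trans h1

/-- A simple `J`-gallery of `𝒞₊` lifts to a `J`-gallery of `Opp(𝒞)` with prescribed initial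
chamber. -/
theorem exists_jPath_lift {J : Set I} {m : List T.Cp} {f : T.Cp} {a : OppC T}
    (h : JPath T.adjp J a.1.1 m f) (hm : (a.1.1 :: m).IsChain (· ≠ ·)) :
    ∃ k b, b.1.1 = f ∧ JPath (oppAdj T) J a k b ∧ Lift a k b m ∧
      InResidue T.adjm J a.1.2 b.1.2 := by
  generalize he : a.1.1 = e at h
  induction h generalizing a with
  | nil => exact ⟨[], a, he, .nil a, .nil a, .refl⟩
  | @cons e d f m hed _ ih =>
    subst he
    rw [List.isChain_cons_cons] at hm
    obtain ⟨j, hj, hed⟩ := hed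
    obtain ⟨z, hz, -, hdz⟩ := T.tcs2p j a.1.1 d a.1.2 hed a.2
    let y : OppC T := ⟨(d, z), hdz⟩
    have hay : oppAdj T j a y := ⟨hed, hz⟩
    obtain ⟨k, b, hb, h1, h2, h3⟩ := ih (a := y) hm.2 rfl
    exact ⟨y :: k, b, hb, .cons ⟨j, hj, hay⟩ h1, .move ⟨j, hay⟩ hm.1 h2, .head ⟨j, hj, hz⟩ h3⟩

theorem InResidue.symm {adj : I → C → C → Prop} (hadj : ∀ i, Equivalence (adj i)) {J : Set I}
    {c d : C} (h : InResidue adj J c d) : InResidue adj J d c := by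
  induction h with
  | refl => exact .refl
  | tail _ h ih =>
    obtain ⟨j, hj, h⟩ := h
    exact .head ⟨j, hj, (hadj j).symm h⟩ ih

/-- A gallery of `Opp(𝒞)` over a simple `J`-gallery, `|J| ≤ 2`, is homotopic to a gallery over
any other simple `J`-gallery with the same extremities. -/
theorem Lift.exists_homotopic (hT : TwinSC T) {J : Set I} (hJ : J.Finite) (hJ2 : J.ncard ≤ 2)
    {a b : OppC T} {l : List (OppC T)} {m m' : List T.Cp} (h : Lift a l b m)
    (hm : JPath T.adjp J a.1.1 m b.1.1) (hm' : JPath T.adjp J a.1.1 m' b.1.1)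
    (hs : (a.1.1 :: m).IsChain (· ≠ ·)) (hs' : (a.1.1 :: m').IsChain (· ≠ ·)) :
    ∃ l', Lift a l' b m' ∧ Homotopic (oppAdj T) (a :: l) (a :: l') := by
  obtain ⟨k, y, hy, hk, hkl, hkr⟩ := exists_jPath_lift hm hs
  obtain ⟨k', y', hy', hk', hkl', hkr'⟩ := exists_jPath_lift hm' hs'
  obtain ⟨t, ht, htl⟩ := exists_jPath_lift_const (a := y') (b := y) hJ hJ2 (hy'.trans hy.symm)
    ((InResidue.symm T.eqvm hkr').trans hkr)
  obtain ⟨r, hr⟩ := exists_lift_const hy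
  have h1 := h.homotopic_append hT (by simpa using hkl.append hr) (.nil a)
  have h2 := (JPath.homotopic hJ hJ2 hk (hk'.append ht)).append_right r
  refine ⟨k' ++ t ++ r, by simpa using hkl'.append (htl.append hr), h1.trans ?_⟩
  rwa [List.cons_append, List.cons_append] at h2

/-- The reduced gallery has no two equal consecutive chambers. -/
theorem isChain_reduced (l : List C) : (reduced l).IsChain (· ≠ ·) := by
  classical
  exact List.isChain_destutter _ _

end Lift

/-- Let `𝒞` be a simply connected twin chamber system, `G` a gallery in
`Opp(𝒞)`, and `X` a simple gallery in `𝒞₊` such that the reduced gallery `(G₊)*` of the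
`𝒞₊`-component of `G` is elementary homotopic to `X`. Then there is a gallery `H` in `Opp(𝒞)`
homotopic to `G` with `(H₊)* = X`. -/
theorem exists_homotopic_with_reduced_plus_component {I : Type u} (T : TwinCS.{u, v} I)
    (hT : TwinSC T) (G : List (OppC T)) (hG : IsGallery (oppAdj T) G)
    (X : List T.Cp) (hX : IsGallery T.adjp X) (hsimple : X.Chain' (· ≠ ·))
    (hel : ElemHomotopic T.adjp (reduced (G.map (fun u => u.1.1))) X) :
    ∃ H : List (OppC T), IsGallery (oppAdj T) H ∧ Homotopic (oppAdj T) G H ∧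
      reduced (H.map (fun u => u.1.1)) = X := by
  obtain ⟨P, M, M', S, J, hJ, hJ2, hM, hM', hhead, hlast, hMc, hMc', hGX, rfl⟩ := hel
  obtain ⟨e, m, rfl⟩ := List.exists_cons_of_ne_nil hM
  obtain ⟨e', m', rfl⟩ := List.exists_cons_of_ne_nil hM'
  obtain rfl : e = e' := by simpa using hhead
  obtain ⟨a, l, rfl⟩ := List.exists_cons_of_ne_nil hG.1
  obtain ⟨d, s, hl⟩ := Lift.exists_of_isChain hG.2
  have hred := isChain_reduced ((a :: l).map fun u => u.1.1)
  rw [hGX] at hred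
  rw [hl.reduced_eq] at hGX
  obtain ⟨q, hq⟩ : ∃ q, P ++ [e] = a.1.1 :: q := by
    cases P with
    | nil => exact ⟨[], by simp at hGX; simp [hGX.1]⟩
    | cons p P => exact ⟨P ++ [e], by simp at hGX; simp [hGX.1]⟩
  have hP : ∀ n : List T.Cp, P ++ e :: n ++ S = a.1.1 :: (q ++ n ++ S) := by
    intro n
    have := congrArg (· ++ n ++ S) hq
    simpa using this
  rw [hP] at hGX
  obtain rfl : s = q ++ m ++ S := (List.cons_eq_cons.1 hGX).2
  obtain ⟨c, l₁₂, l₃, rfl, h₁₂, h₃⟩ := hl.split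
  obtain ⟨b, l₁, l₂, rfl, h₁, h₂⟩ := h₁₂.split
  obtain rfl : e = b.1.1 := by
    have := h₁.getLast?
    rw [← hq] at this
    simpa using this
  have hsub : ∀ n : List T.Cp, (P ++ b.1.1 :: n ++ S).IsChain (· ≠ ·) →
      (b.1.1 :: n).IsChain (· ≠ ·) := fun n hn =>
    hn.infix ⟨P, S, rfl⟩
  have hmc := h₂.getLast?
  obtain ⟨k, hk, hhk⟩ := h₂.exists_homotopic hT hJ hJ2 (.of_isChain hMc hmc)
    (.of_isChain hMc' (hlast ▸ hmc)) (hsub m hred) (hsub m' hsimple)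
  have hfin := (h₁.append hk).append h₃
  refine ⟨_, ⟨List.cons_ne_nil _ _, hfin.isChain⟩, ?_, ?_⟩
  · exact (Homotopic.lift_append h₁ hhk).append_right l₃
  · rw [hfin.reduced_eq, hP]

end TwinChamber
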